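/- Let α>1 and 0<β<∞, let u be holomorphic on 𝔻 and φ a holomorphic self-map of 𝔻. Then uC_φ maps B^α boundedly into Z_β if and only if sup_{z∈𝔻} (1-|z|²)^β |2u'(z)φ'(z) + u(z)φ''(z)| / (1-|φ(z)|²)^α < ∞, sup_{z∈𝔻} (1-|z|²)^β |u(z)| |φ'(z)|² / (1-|φ(z)|²)^{α+1} < ∞, and sup_{z∈𝔻} (1-|z|²)^β |u''(z)| / (1-|φ(z)|²)^{α-1} < ∞. -/

import Mathlib

open Complex Filter Set

noncomputable section

/-- The open unit disk in `ℂ`. -/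
def unitDisk : Set ℂ := Metric.ball 0 1

/-- The weighted sup-norm `‖g‖_{ν_γ} = sup_{z ∈ 𝔻} (1-|z|²)^γ |g(z)|`. -/
def wnorm (γ : ℝ) (g : ℂ → ℂ) : ℝ :=
  sSup ((fun z => (1 - ‖z‖ ^ 2) ^ γ * ‖g z‖) '' unitDisk)

/-- Membership in the weighted Banach space `H^∞_{ν_β}`. -/
def MemWeighted (β : ℝ) (g : ℂ → ℂ) : Prop :=
  DifferentiableOn ℂ g unitDisk ∧
    BddAbove ((fun z => (1 - ‖z‖ ^ 2) ^ β * ‖g z‖) '' unitDisk)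

/-- Membership in the Bloch type space `B^α`. -/
def MemBloch (α : ℝ) (f : ℂ → ℂ) : Prop :=
  DifferentiableOn ℂ f unitDisk ∧
    BddAbove ((fun z => (1 - ‖z‖ ^ 2) ^ α * ‖deriv f z‖) '' unitDisk)

/-- The Bloch type norm `‖f‖_{B^α} = |f(0)| + sup_{z∈𝔻}(1-|z|²)^α |f'(z)|`. -/
def blochNorm (α : ℝ) (f : ℂ → ℂ) : ℝ :=
  ‖f 0‖ + wnorm α (deriv f)

/-- Membership in the Zygmund type space `Z_β`. -/
def MemZygmund (β : ℝ) (f : ℂ → ℂ) : Prop :=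
  DifferentiableOn ℂ f unitDisk ∧
    BddAbove ((fun z => (1 - ‖z‖ ^ 2) ^ β * ‖deriv (deriv f) z‖) '' unitDisk)

/-- The Zygmund type norm `‖f‖_{Z_β} = |f(0)| + |f'(0)| + sup_{z∈𝔻}(1-|z|²)^β |f''(z)|`. -/
def zygNorm (β : ℝ) (f : ℂ → ℂ) : ℝ :=
  ‖f 0‖ + ‖deriv f 0‖ + wnorm β (deriv (deriv f))

/-- The weighted composition operator `uC_φ f = u · (f ∘ φ)`. -/
def wcomp (u φ f : ℂ → ℂ) : ℂ → ℂ := fun z => u z * f (φ z)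

/-- `uC_φ` maps `B^α` boundedly into `Z_β`. -/
def BoundedBlochToZygmund (α β : ℝ) (u φ : ℂ → ℂ) : Prop :=
  (∀ f, MemBloch α f → MemZygmund β (wcomp u φ f)) ∧
    ∃ C > 0, ∀ f, MemBloch α f → zygNorm β (wcomp u φ f) ≤ C * blochNorm α f

/-- `uC_φ` maps `B^α` boundedly into `H^∞_{ν_β}`. -/
def BoundedBlochToWeighted (α β : ℝ) (u φ : ℂ → ℂ) : Prop :=
  (∀ f, MemBloch α f → MemWeighted β (wcomp u φ f)) ∧
    ∃ C > 0, ∀ f, MemBloch α f → wnorm β (wcomp u φ f) ≤ C * blochNorm α f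

/-- `uC_φ : B^α → Z_β` is compact: it is bounded and maps bounded sets of `B^α` to
totally bounded (equivalently, since `Z_β` is complete, relatively compact) subsets
of `Z_β`. -/
def CompactBlochToZygmund (α β : ℝ) (u φ : ℂ → ℂ) : Prop :=
  BoundedBlochToZygmund α β u φ ∧
    ∀ r : ℝ, ∀ ε : ℝ, 0 < ε → ∃ T : Finset (ℂ → ℂ),
      (∀ g ∈ T, MemZygmund β g) ∧
      ∀ f, MemBloch α f → blochNorm α f ≤ r →
        ∃ g ∈ T, zygNorm β (fun z => wcomp u φ f z - g z) ≤ ε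

/-- `uC_φ : B^α → H^∞_{ν_β}` is compact: it is bounded and maps bounded sets of `B^α`
to totally bounded (equivalently, relatively compact) subsets of `H^∞_{ν_β}`. -/
def CompactBlochToWeighted (α β : ℝ) (u φ : ℂ → ℂ) : Prop :=
  BoundedBlochToWeighted α β u φ ∧
    ∀ r : ℝ, ∀ ε : ℝ, 0 < ε → ∃ T : Finset (ℂ → ℂ),
      (∀ g ∈ T, MemWeighted β g) ∧
      ∀ f, MemBloch α f → blochNorm α f ≤ r →
        ∃ g ∈ T, wnorm β (fun z => wcomp u φ f z - g z) ≤ ε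

/-- A compact (linear, bounded, with totally bounded image of the unit ball) operator
from the subspace of `B^α` cut out by the predicate `P` into `Z_β`. -/
def IsCompactOpToZygmund (α β : ℝ) (P : (ℂ → ℂ) → Prop) (K : (ℂ → ℂ) → ℂ → ℂ) : Prop :=
  (∀ f g, P f → P g → ∀ a b : ℂ,
      K (fun z => a * f z + b * g z) = fun z => a * K f z + b * K g z) ∧
  (∀ f, P f → MemZygmund β (K f)) ∧
  (∃ C, ∀ f, P f → zygNorm β (K f) ≤ C * blochNorm α f) ∧
  (∀ ε : ℝ, 0 < ε → ∃ T : Finset (ℂ → ℂ), (∀ g ∈ T, MemZygmund β g) ∧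
      ∀ f, P f → blochNorm α f ≤ 1 → ∃ g ∈ T, zygNorm β (fun z => K f z - g z) ≤ ε)

/-- The essential norm of `uC_φ`, as an operator from the subspace of `B^α` cut out by
the predicate `P` into `Z_β`: the distance to the compact operators, the operator norm
being the supremum over the unit ball. -/
def essNormZ (α β : ℝ) (P : (ℂ → ℂ) → Prop) (u φ : ℂ → ℂ) : ℝ :=
  sInf {r | ∃ K, IsCompactOpToZygmund α β P K ∧
    r = sSup {s | ∃ f, P f ∧ blochNorm α f ≤ 1 ∧
          s = zygNorm β (fun z => wcomp u φ f z - K f z)}}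

/-- A compact (linear, bounded, with totally bounded image of the unit ball) operator
from `B^α` into `H^∞_{ν_β}`. -/
def IsCompactOpToWeighted (α β : ℝ) (K : (ℂ → ℂ) → ℂ → ℂ) : Prop :=
  (∀ f g, MemBloch α f → MemBloch α g → ∀ a b : ℂ,
      K (fun z => a * f z + b * g z) = fun z => a * K f z + b * K g z) ∧
  (∀ f, MemBloch α f → MemWeighted β (K f)) ∧
  (∃ C, ∀ f, MemBloch α f → wnorm β (K f) ≤ C * blochNorm α f) ∧
  (∀ ε : ℝ, 0 < ε → ∃ T : Finset (ℂ → ℂ), (∀ g ∈ T, MemWeighted β g) ∧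
      ∀ f, MemBloch α f → blochNorm α f ≤ 1 → ∃ g ∈ T, wnorm β (fun z => K f z - g z) ≤ ε)

/-- The essential norm of `uC_φ : B^α → H^∞_{ν_β}`. -/
def essNormW (α β : ℝ) (u φ : ℂ → ℂ) : ℝ :=
  sInf {r | ∃ K, IsCompactOpToWeighted α β K ∧
    r = sSup {s | ∃ f, MemBloch α f ∧ blochNorm α f ≤ 1 ∧
          s = wnorm β (fun z => wcomp u φ f z - K f z)}}

/-- `limsup_{|φ(z)|→1} F(z) = lim_{s→1⁻} sup {F z : z ∈ 𝔻, |φ z| > s}`.  Since the inner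
supremum is nonincreasing in `s`, the limit equals the infimum over `s ∈ [0,1)`; note
that `Real.sSup ∅ = 0`, matching the convention that the value is `0` when
`{z : |φ z| > s}` is empty for some `s < 1`. -/
def phiLimsup (φ : ℂ → ℂ) (F : ℂ → ℝ) : ℝ :=
  sInf ((fun s => sSup {y | ∃ z ∈ unitDisk, s < ‖φ z‖ ∧ y = F z}) '' Set.Ico (0:ℝ) 1)

open ComplexConjugate in
/-- The kernel `(1 - \bar a z)^{-p}`. -/
def diskKernel (a : ℂ) (p : ℝ) (z : ℂ) : ℂ := (1 - conj a * z) ^ ((-p : ℝ) : ℂ)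

theorem isOpen_unitDisk : IsOpen unitDisk := Metric.isOpen_ball

theorem mem_unitDisk {z : ℂ} : z ∈ unitDisk ↔ ‖z‖ < 1 := mem_ball_zero_iff

theorem zero_mem_unitDisk : (0 : ℂ) ∈ unitDisk := by simp [mem_unitDisk]

theorem one_sub_sq_pos {z : ℂ} (hz : z ∈ unitDisk) : 0 < 1 - ‖z‖ ^ 2 := by
  rw [mem_unitDisk] at hz
  nlinarith [norm_nonneg z]

theorem DifferentiableOn.hasDerivAt_unitDisk {f : ℂ → ℂ} (hf : DifferentiableOn ℂ f unitDisk)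
    {z : ℂ} (hz : z ∈ unitDisk) : HasDerivAt f (_root_.deriv f z) z :=
  (hf.differentiableAt (isOpen_unitDisk.mem_nhds hz)).hasDerivAt

theorem wnorm_nonneg (γ : ℝ) (g : ℂ → ℂ) : 0 ≤ wnorm γ g := by
  apply Real.sSup_nonneg
  rintro _ ⟨z, hz, rfl⟩
  have := one_sub_sq_pos hz
  positivity

theorem wnorm_le {γ C : ℝ} {g : ℂ → ℂ}
    (h : ∀ z ∈ unitDisk, (1 - ‖z‖ ^ 2) ^ γ * ‖g z‖ ≤ C) : wnorm γ g ≤ C := by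
  apply csSup_le (Set.Nonempty.image _ ⟨0, zero_mem_unitDisk⟩)
  rintro _ ⟨z, hz, rfl⟩
  exact h z hz

theorem bddAbove_weighted {γ C : ℝ} {g : ℂ → ℂ}
    (h : ∀ z ∈ unitDisk, (1 - ‖z‖ ^ 2) ^ γ * ‖g z‖ ≤ C) :
    BddAbove ((fun z => (1 - ‖z‖ ^ 2) ^ γ * ‖g z‖) '' unitDisk) := by
  refine ⟨C, ?_⟩
  rintro _ ⟨z, hz, rfl⟩
  exact h z hz

/-! ### Growth of Bloch functions -/

theorem norm_deriv_le_of_memBloch {α : ℝ} {f : ℂ → ℂ} (hf : MemBloch α f) {z : ℂ}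
    (hz : z ∈ unitDisk) : ‖deriv f z‖ ≤ wnorm α (deriv f) * (1 - ‖z‖ ^ 2) ^ (-α) := by
  have h : (1 - ‖z‖ ^ 2) ^ α * ‖deriv f z‖ ≤ wnorm α (deriv f) :=
    le_csSup hf.2 ⟨z, hz, rfl⟩
  have hd := one_sub_sq_pos hz
  rw [Real.rpow_neg hd.le, ← div_eq_mul_inv, le_div_iff₀ (by positivity)]
  linarith

theorem norm_deriv_deriv_le_of_memBloch {α : ℝ} (hα : 0 ≤ α) {f : ℂ → ℂ} (hf : MemBloch α f)
    {w : ℂ} (hw : w ∈ unitDisk) :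
    ‖deriv (deriv f) w‖ ≤ 4 ^ (α + 1) * wnorm α (deriv f) * (1 - ‖w‖ ^ 2) ^ (-(α + 1)) := by
  set M := wnorm α (deriv f)
  have hM : 0 ≤ M := wnorm_nonneg _ _
  have hd := one_sub_sq_pos hw
  have hw1 := mem_unitDisk.1 hw
  have hw0 := norm_nonneg w
  set R := (1 - ‖w‖) / 2 with hR
  have hRpos : 0 < R := by rw [hR]; linarith
  have hball : Metric.closedBall w R ⊆ unitDisk := by
    intro z hz
    rw [mem_closedBall_iff_norm] at hz
    rw [mem_unitDisk]
    have := norm_le_norm_add_norm_sub' z w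
    linarith
  have hbound : ∀ z ∈ Metric.sphere w R, ‖deriv f z‖ ≤ M * R ^ (-α) := by
    intro z hz
    have hzD := hball (Metric.sphere_subset_closedBall hz)
    refine (norm_deriv_le_of_memBloch hf hzD).trans ?_
    rw [mem_sphere_iff_norm] at hz
    have h1 := norm_le_norm_add_norm_sub' z w
    have h2 : R ≤ 1 - ‖z‖ ^ 2 := by nlinarith [norm_nonneg z, mem_unitDisk.1 hzD]
    gcongr M * ?_
    exact Real.rpow_le_rpow_of_nonpos hRpos h2 (by linarith)
  have hdiff : DifferentiableOn ℂ (deriv f) unitDisk := hf.1.deriv isOpen_unitDisk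
  have hcl : DiffContOnCl ℂ (deriv f) (Metric.ball w R) :=
    (hdiff.mono (Metric.closure_ball_subset_closedBall.trans hball)).diffContOnCl
  have h := norm_deriv_le_of_forall_mem_sphere_norm_le hRpos hcl hbound
  have hR4 : (1 - ‖w‖ ^ 2) / 4 ≤ R := by rw [hR]; nlinarith
  calc ‖deriv (deriv f) w‖ ≤ M * R ^ (-α) / R := h
    _ = M * R ^ (-(α + 1)) := by
      rw [show -(α + 1) = -α - 1 by ring, Real.rpow_sub_one hRpos.ne']; ring
    _ ≤ M * ((1 - ‖w‖ ^ 2) / 4) ^ (-(α + 1)) := by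
      gcongr M * ?_
      exact Real.rpow_le_rpow_of_nonpos (by positivity) hR4 (by linarith)
    _ = 4 ^ (α + 1) * M * (1 - ‖w‖ ^ 2) ^ (-(α + 1)) := by
      rw [Real.div_rpow hd.le (by norm_num), Real.rpow_neg (by norm_num : (0:ℝ) ≤ 4),
        div_inv_eq_mul]
      ring

theorem norm_le_of_memBloch {α : ℝ} (hα : 1 < α) {f : ℂ → ℂ} (hf : MemBloch α f)
    {w : ℂ} (hw : w ∈ unitDisk) :
    ‖f w‖ ≤ (1 + 2 ^ (α - 1) / (α - 1)) * blochNorm α f * (1 - ‖w‖ ^ 2) ^ (-(α - 1)) := by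
  set M := wnorm α (deriv f)
  have hM : 0 ≤ M := wnorm_nonneg _ _
  have hd := one_sub_sq_pos hw
  have hw1 := mem_unitDisk.1 hw
  have hw0 := norm_nonneg w
  have hα1 : 0 < α - 1 := by linarith
  set r := ‖w‖ with hr
  have hpos : ∀ t ∈ Icc (0:ℝ) 1, 0 < 1 - t * r := by
    intro t ht
    nlinarith [ht.1, ht.2]
  have hmem : ∀ t ∈ Icc (0:ℝ) 1, (t : ℂ) * w ∈ unitDisk := by
    intro t ht
    rw [mem_unitDisk, norm_mul, Complex.norm_real, Real.norm_of_nonneg ht.1]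
    linarith [hpos t ht]
  have hderiv : ∀ t ∈ Icc (0:ℝ) 1,
      HasDerivAt (fun t : ℝ => f ((t : ℂ) * w) - f 0) (deriv f ((t : ℂ) * w) * w) t := by
    intro t ht
    have h1 : HasDerivAt (fun s : ℂ => s * w) w (t : ℂ) := by
      simpa using (hasDerivAt_id (t : ℂ)).mul_const w
    exact ((HasDerivAt.comp (t : ℂ)
      (hf.1.hasDerivAt_unitDisk (hmem t ht)) h1).comp_ofReal).sub_const _
  have hB : ∀ t ∈ Icc (0:ℝ) 1,
      HasDerivAt (fun t : ℝ => M / (α - 1) * (1 - t * r) ^ (-(α - 1)))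
        (M * r * (1 - t * r) ^ (-α)) t := by
    intro t ht
    have h1 : HasDerivAt (fun t : ℝ => 1 - t * r) (-r) t := by
      simpa using ((hasDerivAt_id t).mul_const r).const_sub 1
    refine ((h1.rpow_const (p := -(α - 1))
      (Or.inl (hpos t ht).ne')).const_mul (M / (α - 1))).congr_deriv ?_
    rw [show -(α - 1) - 1 = -α by ring]
    field_simp
  have key := image_norm_le_of_norm_deriv_right_le_deriv_boundary' (a := (0:ℝ)) (b := 1)
    (f := fun t : ℝ => f ((t : ℂ) * w) - f 0)
    (fun t ht => (hderiv t ht).continuousAt.continuousWithinAt)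
    (fun t ht => (hderiv t (Ico_subset_Icc_self ht)).hasDerivWithinAt)
    (B := fun t : ℝ => M / (α - 1) * (1 - t * r) ^ (-(α - 1)))
    (by simp; positivity)
    (fun t ht => (hB t ht).continuousAt.continuousWithinAt)
    (fun t ht => (hB t (Ico_subset_Icc_self ht)).hasDerivWithinAt)
    (by
      intro t ht
      have ht' := Ico_subset_Icc_self ht
      have hp := hpos t ht'
      rw [norm_mul, ← hr]
      have h1 := norm_deriv_le_of_memBloch hf (hmem t ht')
      have h2 : (1 - ‖(t : ℂ) * w‖ ^ 2) ^ (-α) ≤ (1 - t * r) ^ (-α) := by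
        apply Real.rpow_le_rpow_of_nonpos hp _ (by linarith)
        rw [norm_mul, Complex.norm_real, Real.norm_of_nonneg ht.1, ← hr]
        nlinarith [mul_nonneg ht.1 hw0]
      calc _ ≤ M * (1 - t * r) ^ (-α) * r := by
            gcongr
            exact h1.trans (by gcongr)
        _ = _ := by ring)
    (right_mem_Icc.2 zero_le_one)
  simp only [ofReal_one, one_mul] at key
  have hrd : (1 - r) ^ (-(α - 1)) ≤ 2 ^ (α - 1) * (1 - r ^ 2) ^ (-(α - 1)) := by
    calc (1 - r) ^ (-(α - 1)) ≤ ((1 - r ^ 2) / 2) ^ (-(α - 1)) :=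
          Real.rpow_le_rpow_of_nonpos (by positivity) (by nlinarith) (by linarith)
      _ = _ := by
        rw [Real.div_rpow hd.le (by norm_num), Real.rpow_neg (by norm_num : (0:ℝ) ≤ 2),
          div_inv_eq_mul]
        ring
  have hone : 1 ≤ (1 - r ^ 2) ^ (-(α - 1)) :=
    Real.one_le_rpow_of_pos_of_le_one_of_nonpos hd (by nlinarith) (by linarith)
  set D := (1 - r ^ 2) ^ (-(α - 1))
  have h0 := norm_nonneg (f 0)
  have hc : 0 ≤ (2:ℝ) ^ (α - 1) / (α - 1) := by positivity
  have e : blochNorm α f = ‖f 0‖ + M := rfl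
  rw [e]
  calc ‖f w‖ ≤ ‖f 0‖ + ‖f w - f 0‖ := norm_le_norm_add_norm_sub' _ _
    _ ≤ ‖f 0‖ * D + M / (α - 1) * (2 ^ (α - 1) * D) := by
      gcongr
      · exact le_mul_of_one_le_right h0 hone
      · exact key.trans (by gcongr)
    _ = (‖f 0‖ + 2 ^ (α - 1) / (α - 1) * M) * D := by ring
    _ ≤ (1 + 2 ^ (α - 1) / (α - 1)) * (‖f 0‖ + M) * D := by
      gcongr
      nlinarith [mul_nonneg hc h0]

/-! ### Derivatives of the weighted composition -/

section wcomp

variable {u φ f : ℂ → ℂ} {z : ℂ}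

theorem hasDerivAt_wcomp (hu : DifferentiableOn ℂ u unitDisk)
    (hφd : DifferentiableOn ℂ φ unitDisk) (hφm : Set.MapsTo φ unitDisk unitDisk)
    (hf : DifferentiableOn ℂ f unitDisk) (hz : z ∈ unitDisk) :
    HasDerivAt (wcomp u φ f) (wcomp (deriv u) φ f z + wcomp u φ (deriv f) z * deriv φ z) z := by
  have h := (hu.hasDerivAt_unitDisk hz).mul
    ((hf.hasDerivAt_unitDisk (hφm hz)).comp z (hφd.hasDerivAt_unitDisk hz))
  refine h.congr_deriv ?_
  simp only [wcomp, Function.comp]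
  ring

theorem deriv_deriv_wcomp (hu : DifferentiableOn ℂ u unitDisk)
    (hφd : DifferentiableOn ℂ φ unitDisk) (hφm : Set.MapsTo φ unitDisk unitDisk)
    (hf : DifferentiableOn ℂ f unitDisk) (hz : z ∈ unitDisk) :
    deriv (deriv (wcomp u φ f)) z = deriv (deriv u) z * f (φ z)
      + (2 * deriv u z * deriv φ z + u z * deriv (deriv φ) z) * deriv f (φ z)
      + u z * deriv φ z ^ 2 * deriv (deriv f) (φ z) := by
  have he : deriv (wcomp u φ f) =ᶠ[nhds z]
      fun z => wcomp (deriv u) φ f z + wcomp u φ (deriv f) z * deriv φ z := by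
    filter_upwards [isOpen_unitDisk.mem_nhds hz] with y hy
    exact (hasDerivAt_wcomp hu hφd hφm hf hy).deriv
  have h := (hasDerivAt_wcomp (hu.deriv isOpen_unitDisk) hφd hφm hf hz).add
    ((hasDerivAt_wcomp hu hφd hφm (hf.deriv isOpen_unitDisk) hz).mul
      ((hφd.deriv isOpen_unitDisk).hasDerivAt_unitDisk hz))
  rw [he.deriv_eq]
  refine h.deriv.trans ?_
  simp only [wcomp]
  ring

end wcomp

/-! ### Test functions -/

section kernel

open ComplexConjugate

variable {a z : ℂ}

theorem one_sub_norm_le_norm_one_sub_conj_mul (ha : a ∈ unitDisk) :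
    1 - ‖z‖ ≤ ‖1 - conj a * z‖ := by
  have h := norm_sub_norm_le 1 (conj a * z)
  rw [norm_one, norm_mul, RCLike.norm_conj] at h
  nlinarith [norm_nonneg z, mem_unitDisk.1 ha]

theorem norm_one_sub_conj_mul_pos (ha : a ∈ unitDisk) (hz : z ∈ unitDisk) :
    0 < ‖1 - conj a * z‖ := by
  linarith [one_sub_norm_le_norm_one_sub_conj_mul (z := z) ha, mem_unitDisk.1 hz]

theorem norm_sub_le_norm_one_sub_conj_mul (ha : a ∈ unitDisk) (hz : z ∈ unitDisk) :
    ‖z - a‖ ≤ ‖1 - conj a * z‖ := by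
  have h : ‖z - a‖ ^ 2 + (1 - ‖a‖ ^ 2) * (1 - ‖z‖ ^ 2) = ‖1 - conj a * z‖ ^ 2 := by
    simp only [← Complex.normSq_eq_norm_sq, Complex.normSq_apply]
    simp
    ring
  have := mul_pos (one_sub_sq_pos ha) (one_sub_sq_pos hz)
  exact le_of_sq_le_sq (by linarith) (norm_nonneg _)

theorem norm_diskKernel (p : ℝ) : ‖diskKernel a p z‖ = ‖1 - conj a * z‖ ^ (-p) :=
  norm_cpow_real _ _

theorem norm_diskKernel_self (p : ℝ) (ha : a ∈ unitDisk) :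
    ‖diskKernel a p a‖ = (1 - ‖a‖ ^ 2) ^ (-p) := by
  have h : (1 : ℂ) - conj a * a = ((1 - ‖a‖ ^ 2 : ℝ) : ℂ) := by
    rw [Complex.conj_mul']; push_cast; rfl
  rw [norm_diskKernel, h, Complex.norm_real, Real.norm_of_nonneg (one_sub_sq_pos ha).le]

theorem norm_sub_mul_diskKernel_le (p : ℝ) (ha : a ∈ unitDisk) (hz : z ∈ unitDisk) :
    ‖z - a‖ * ‖diskKernel a (p + 1) z‖ ≤ ‖diskKernel a p z‖ := by
  have hpos := norm_one_sub_conj_mul_pos ha hz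
  rw [norm_diskKernel, norm_diskKernel, show -(p + 1) = -p - 1 by ring,
    Real.rpow_sub_one hpos.ne', mul_div_assoc', div_le_iff₀ hpos, mul_comm]
  gcongr
  exact norm_sub_le_norm_one_sub_conj_mul ha hz

theorem hasDerivAt_diskKernel (p : ℝ) (ha : a ∈ unitDisk) (hz : z ∈ unitDisk) :
    HasDerivAt (diskKernel a p) (p * conj a * diskKernel a (p + 1) z) z := by
  have h1 : HasDerivAt (fun z => 1 - conj a * z) (-conj a) z := by
    simpa using ((hasDerivAt_id z).const_mul (conj a)).const_sub 1
  have hs : 1 - conj a * z ∈ slitPlane := by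
    left
    have h2 : (conj a * z).re ≤ ‖conj a * z‖ := Complex.re_le_norm _
    rw [norm_mul, RCLike.norm_conj] at h2
    rw [Complex.sub_re, Complex.one_re]
    nlinarith [norm_nonneg z, norm_nonneg a, mem_unitDisk.1 ha, mem_unitDisk.1 hz]
  have h := h1.cpow_const (c := ((-p : ℝ) : ℂ)) hs
  refine h.congr_deriv ?_
  rw [diskKernel, show ((-(p + 1) : ℝ) : ℂ) = ((-p : ℝ) : ℂ) - 1 by push_cast; ring]
  push_cast
  ring

theorem memBloch_of_norm_deriv_le {α K : ℝ} (hα : 0 ≤ α) {f f' : ℂ → ℂ}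
    (ha : a ∈ unitDisk) (hf : ∀ z ∈ unitDisk, HasDerivAt f (f' z) z)
    (h : ∀ z ∈ unitDisk, ‖f' z‖ ≤ K * ‖diskKernel a α z‖) (h0 : ‖f 0‖ ≤ 1) :
    MemBloch α f ∧ blochNorm α f ≤ 1 + K * 2 ^ α := by
  have hbound : ∀ z ∈ unitDisk, (1 - ‖z‖ ^ 2) ^ α * ‖deriv f z‖ ≤ K * 2 ^ α := by
    intro z hz
    rw [(hf z hz).deriv]
    have hpos := norm_one_sub_conj_mul_pos ha hz
    have hd := one_sub_sq_pos hz
    have h1 := one_sub_norm_le_norm_one_sub_conj_mul (z := z) ha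
    have h2 : (1 - ‖z‖ ^ 2) ^ α ≤ 2 ^ α * ‖1 - conj a * z‖ ^ α := by
      rw [← Real.mul_rpow (by norm_num) hpos.le]
      apply Real.rpow_le_rpow hd.le _ hα
      nlinarith [norm_nonneg z, mem_unitDisk.1 hz]
    calc (1 - ‖z‖ ^ 2) ^ α * ‖f' z‖
        ≤ 2 ^ α * ‖1 - conj a * z‖ ^ α * (K * ‖1 - conj a * z‖ ^ (-α)) := by
          rw [← norm_diskKernel]
          gcongr
          exact h z hz
      _ = K * 2 ^ α := by
          rw [Real.rpow_neg hpos.le]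
          field_simp
  exact ⟨⟨fun z hz => (hf z hz).differentiableAt.differentiableWithinAt,
    bddAbove_weighted hbound⟩, add_le_add h0 (wnorm_le hbound)⟩

theorem deriv_deriv_eq_of_hasDerivAt {f f' : ℂ → ℂ} {c : ℂ}
    (hf : ∀ z ∈ unitDisk, HasDerivAt f (f' z) z) (hz : z ∈ unitDisk) (h : HasDerivAt f' c z) :
    deriv (deriv f) z = c := by
  have he : deriv f =ᶠ[nhds z] f' := by
    filter_upwards [isOpen_unitDisk.mem_nhds hz] with y hy
    exact (hf y hy).deriv
  rw [he.deriv_eq, h.deriv]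

theorem norm_diskKernel_zero (p : ℝ) : ‖diskKernel a p 0‖ = 1 := by
  simp [norm_diskKernel]

theorem memBloch_diskKernel {α : ℝ} (hα : 1 < α) (ha : a ∈ unitDisk) :
    MemBloch α (diskKernel a (α - 1)) ∧ blochNorm α (diskKernel a (α - 1)) ≤ 1 + (α + 3) * 2 ^ α ∧
    deriv (diskKernel a (α - 1)) a = (α - 1) * conj a * diskKernel a α a ∧
    deriv (deriv (diskKernel a (α - 1))) a =
      (α - 1) * α * conj a ^ 2 * diskKernel a (α + 1) a := by
  have hf : ∀ z ∈ unitDisk, HasDerivAt (diskKernel a (α - 1))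
      ((α - 1) * conj a * diskKernel a α z) z := by
    intro z hz
    simpa using hasDerivAt_diskKernel (α - 1) ha hz
  have ha1 := mem_unitDisk.1 ha
  have hmem := memBloch_of_norm_deriv_le (K := α + 3) (by linarith : 0 ≤ α) ha hf
    (fun z hz => by
      rw [norm_mul, norm_mul, RCLike.norm_conj]
      have : ‖(α - 1 : ℂ)‖ = α - 1 := by
        rw [← ofReal_one, ← ofReal_sub, Complex.norm_real, Real.norm_of_nonneg (by linarith)]
      rw [this]
      gcongr
      nlinarith [norm_nonneg a])
    (norm_diskKernel_zero _).le
  refine ⟨hmem.1, hmem.2, (hf a ha).deriv, deriv_deriv_eq_of_hasDerivAt hf ha ?_⟩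
  refine ((hasDerivAt_diskKernel α ha ha).const_mul ((α - 1) * conj a)).congr_deriv ?_
  ring

theorem memBloch_sub_mul_diskKernel {α : ℝ} (hα : 1 < α) (ha : a ∈ unitDisk) :
    MemBloch α (fun z => (z - a) * diskKernel a α z) ∧
    blochNorm α (fun z => (z - a) * diskKernel a α z) ≤ 1 + (α + 3) * 2 ^ α ∧
    deriv (fun z => (z - a) * diskKernel a α z) a = diskKernel a α a ∧
    deriv (deriv (fun z => (z - a) * diskKernel a α z)) a =
      2 * α * conj a * diskKernel a (α + 1) a := by
  have hf : ∀ z ∈ unitDisk, HasDerivAt (fun z => (z - a) * diskKernel a α z)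
      (diskKernel a α z + (z - a) * (α * conj a * diskKernel a (α + 1) z)) z := by
    intro z hz
    refine (((hasDerivAt_id z).sub_const a).mul (hasDerivAt_diskKernel α ha hz)).congr_deriv ?_
    simp
  have ha1 := mem_unitDisk.1 ha
  have hmem := memBloch_of_norm_deriv_le (K := α + 3) (by linarith : 0 ≤ α) ha hf
    (fun z hz => by
      have h := norm_sub_mul_diskKernel_le α ha hz
      have hn := norm_nonneg (diskKernel a α z)
      refine (norm_add_le _ _).trans ?_
      rw [norm_mul, norm_mul, norm_mul, RCLike.norm_conj, Complex.norm_real,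
        Real.norm_of_nonneg (by linarith)]
      have h1 : α * ‖a‖ ≤ α := by nlinarith [norm_nonneg a]
      calc _ = ‖diskKernel a α z‖ + (α * ‖a‖) * (‖z - a‖ * ‖diskKernel a (α + 1) z‖) := by ring
        _ ≤ ‖diskKernel a α z‖ + α * ‖diskKernel a α z‖ := by gcongr
        _ ≤ _ := by nlinarith)
    (by simpa [norm_diskKernel_zero] using ha1.le)
  refine ⟨hmem.1, hmem.2, by simpa using (hf a ha).deriv, deriv_deriv_eq_of_hasDerivAt hf ha ?_⟩
  refine ((hasDerivAt_diskKernel α ha ha).add (((hasDerivAt_id a).sub_const a).mul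
    ((hasDerivAt_diskKernel (α + 1) ha ha).const_mul (α * conj a)))).congr_deriv ?_
  simp
  ring

theorem memBloch_sub_sq_mul_diskKernel {α : ℝ} (hα : 1 < α) (ha : a ∈ unitDisk) :
    MemBloch α (fun z => (z - a) ^ 2 * diskKernel a (α + 1) z) ∧
    blochNorm α (fun z => (z - a) ^ 2 * diskKernel a (α + 1) z) ≤ 1 + (α + 3) * 2 ^ α ∧
    deriv (fun z => (z - a) ^ 2 * diskKernel a (α + 1) z) a = 0 ∧
    deriv (deriv (fun z => (z - a) ^ 2 * diskKernel a (α + 1) z)) a =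
      2 * diskKernel a (α + 1) a := by
  have hsq (z : ℂ) : HasDerivAt (fun z => (z - a) ^ 2) (2 * (z - a)) z := by
    refine (((hasDerivAt_id z).sub_const a).pow 2).congr_deriv ?_
    simp
  have hf : ∀ z ∈ unitDisk, HasDerivAt (fun z => (z - a) ^ 2 * diskKernel a (α + 1) z)
      (2 * (z - a) * diskKernel a (α + 1) z +
        (z - a) ^ 2 * ((α + 1) * conj a * diskKernel a (α + 1 + 1) z)) z := by
    intro z hz
    refine ((hsq z).mul (hasDerivAt_diskKernel (α + 1) ha hz)).congr_deriv ?_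
    simp
  have ha1 := mem_unitDisk.1 ha
  have hmem := memBloch_of_norm_deriv_le (K := α + 3) (by linarith : 0 ≤ α) ha hf
    (fun z hz => by
      have h := norm_sub_mul_diskKernel_le α ha hz
      have h' := norm_sub_mul_diskKernel_le (α + 1) ha hz
      have hn := norm_nonneg (diskKernel a α z)
      have hα1 : ‖(α + 1 : ℂ)‖ = α + 1 := by
        rw [← ofReal_one, ← ofReal_add, Complex.norm_real, Real.norm_of_nonneg (by linarith)]
      refine (norm_add_le _ _).trans ?_
      simp only [norm_mul, norm_pow, RCLike.norm_conj, hα1, Complex.norm_ofNat]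
      have h1 : (α + 1) * ‖a‖ ≤ α + 1 := by nlinarith [norm_nonneg a]
      calc _ = 2 * (‖z - a‖ * ‖diskKernel a (α + 1) z‖) + ((α + 1) * ‖a‖) *
              (‖z - a‖ * (‖z - a‖ * ‖diskKernel a (α + 1 + 1) z‖)) := by ring
        _ ≤ 2 * (‖z - a‖ * ‖diskKernel a (α + 1) z‖) + (α + 1) *
              (‖z - a‖ * ‖diskKernel a (α + 1) z‖) := by gcongr
        _ = (α + 3) * (‖z - a‖ * ‖diskKernel a (α + 1) z‖) := by ring
        _ ≤ _ := by gcongr)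
    (by simpa [norm_diskKernel_zero] using ha1.le)
  refine ⟨hmem.1, hmem.2, by simpa using (hf a ha).deriv, deriv_deriv_eq_of_hasDerivAt hf ha ?_⟩
  refine (((((hasDerivAt_id a).sub_const a).const_mul 2).mul
    (hasDerivAt_diskKernel (α + 1) ha ha)).add ((hsq a).mul
    ((hasDerivAt_diskKernel (α + 1 + 1) ha ha).const_mul ((α + 1) * conj a)))).congr_deriv ?_
  simp

end kernel

theorem div_rpow_eq_mul_rpow_neg {d : ℝ} (hd : 0 ≤ d) (A p : ℝ) : A / d ^ p = A * d ^ (-p) := by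
  rw [Real.rpow_neg hd, div_eq_mul_inv]

/-- **Theorem 3.3** (pointwise form). For `α > 1`, `uC_φ : B^α → Z_β` is bounded iff the
three pointwise weighted suprema are finite. -/
theorem weighted_comp_bounded_Bloch_to_Zygmund_iff_of_one_lt'
    (α β : ℝ) (hα : 1 < α) (hβ : 0 < β)
    (u φ : ℂ → ℂ) (hu : DifferentiableOn ℂ u unitDisk)
    (hφd : DifferentiableOn ℂ φ unitDisk) (hφm : Set.MapsTo φ unitDisk unitDisk) :
    BoundedBlochToZygmund α β u φ ↔
      (∃ C : ℝ, ∀ z ∈ unitDisk,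
        (1 - ‖z‖ ^ 2) ^ β * ‖2 * deriv u z * deriv φ z + u z * deriv (deriv φ) z‖ / (1 - ‖φ z‖ ^ 2) ^ α ≤ C) ∧
      (∃ C : ℝ, ∀ z ∈ unitDisk,
        (1 - ‖z‖ ^ 2) ^ β * (‖u z‖ * ‖deriv φ z‖ ^ 2) / (1 - ‖φ z‖ ^ 2) ^ (α + 1) ≤ C) ∧
      (∃ C : ℝ, ∀ z ∈ unitDisk,
        (1 - ‖z‖ ^ 2) ^ β * ‖deriv (deriv u) z‖ / (1 - ‖φ z‖ ^ 2) ^ (α - 1) ≤ C) := by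
  constructor
  · rintro ⟨hmem, C, hC, hbd⟩
    set N := C * (1 + (α + 3) * 2 ^ α) with hN
    have test : ∀ f, MemBloch α f → blochNorm α f ≤ 1 + (α + 3) * 2 ^ α → ∀ z ∈ unitDisk,
        (1 - ‖z‖ ^ 2) ^ β * ‖deriv (deriv u) z * f (φ z)
          + (2 * deriv u z * deriv φ z + u z * deriv (deriv φ) z) * deriv f (φ z)
          + u z * deriv φ z ^ 2 * deriv (deriv f) (φ z)‖ ≤ N := by
      intro f hf hfN z hz
      rw [← deriv_deriv_wcomp hu hφd hφm hf.1 hz]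
      calc _ ≤ wnorm β (deriv (deriv (wcomp u φ f))) := le_csSup (hmem f hf).2 ⟨z, hz, rfl⟩
        _ ≤ zygNorm β (wcomp u φ f) := le_add_of_nonneg_left (by positivity)
        _ ≤ C * blochNorm α f := hbd f hf
        _ ≤ N := by rw [hN]; gcongr
    have bound₂ : ∀ z ∈ unitDisk,
        (1 - ‖z‖ ^ 2) ^ β * (‖u z‖ * ‖deriv φ z‖ ^ 2) * (1 - ‖φ z‖ ^ 2) ^ (-(α + 1)) ≤ N := by
      intro z hz
      obtain ⟨h1, h2, h3, h4⟩ := memBloch_sub_sq_mul_diskKernel hα (hφm hz)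
      have h := test _ h1 h2 z hz
      have hν := one_sub_sq_pos hz
      have hd := one_sub_sq_pos (hφm hz)
      simp only [h3, h4, sub_self, mul_zero, zero_add, ne_eq, OfNat.ofNat_ne_zero,
        not_false_eq_true, zero_pow, zero_mul, norm_mul, norm_pow, norm_ofNat,
        norm_diskKernel_self _ (hφm hz)] at h
      refine le_trans ?_ h
      have : 0 ≤ (1 - ‖z‖ ^ 2) ^ β * (‖u z‖ * ‖deriv φ z‖ ^ 2) *
        (1 - ‖φ z‖ ^ 2) ^ (-(α + 1)) := by positivity
      linarith
    have bound₁ : ∀ z ∈ unitDisk, (1 - ‖z‖ ^ 2) ^ β *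
        ‖2 * deriv u z * deriv φ z + u z * deriv (deriv φ) z‖ * (1 - ‖φ z‖ ^ 2) ^ (-α) ≤
        N + 2 * α * N := by
      intro z hz
      obtain ⟨h1, h2, h3, h4⟩ := memBloch_sub_mul_diskKernel hα (hφm hz)
      have h := test _ h1 h2 z hz
      have hν := one_sub_sq_pos hz
      have hd := one_sub_sq_pos (hφm hz)
      have hb := bound₂ z hz
      have hφ1 := mem_unitDisk.1 (hφm hz)
      simp only [h3, h4, sub_self, mul_zero, zero_add, zero_mul] at h
      set Y := 2 * deriv u z * deriv φ z + u z * deriv (deriv φ) z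
      have ht := norm_le_add_norm_add (Y * diskKernel (φ z) α (φ z))
        (u z * deriv φ z ^ 2 * (2 * α * (starRingEnd ℂ) (φ z) * diskKernel (φ z) (α + 1) (φ z)))
      simp only [norm_mul, norm_pow, norm_ofNat, RCLike.norm_conj, Complex.norm_real,
        Real.norm_of_nonneg (by linarith : (0:ℝ) ≤ α), norm_diskKernel_self _ (hφm hz)] at ht
      have hY : 0 ≤ (1 - ‖z‖ ^ 2) ^ β := by positivity
      have hmul := mul_le_mul_of_nonneg_left ht hY
      calc _ = (1 - ‖z‖ ^ 2) ^ β * (‖Y‖ * (1 - ‖φ z‖ ^ 2) ^ (-α)) := by ring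
        _ ≤ _ := hmul
        _ = (1 - ‖z‖ ^ 2) ^ β * ‖Y * diskKernel (φ z) α (φ z) + u z * deriv φ z ^ 2 *
              (2 * α * (starRingEnd ℂ) (φ z) * diskKernel (φ z) (α + 1) (φ z))‖
            + 2 * α * ‖φ z‖ * ((1 - ‖z‖ ^ 2) ^ β *
            (‖u z‖ * ‖deriv φ z‖ ^ 2) * (1 - ‖φ z‖ ^ 2) ^ (-(α + 1))) := by ring
        _ ≤ N + 2 * α * 1 * N := by gcongr
        _ = _ := by ring
    have bound₀ : ∀ z ∈ unitDisk, (1 - ‖z‖ ^ 2) ^ β *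
        ‖deriv (deriv u) z‖ * (1 - ‖φ z‖ ^ 2) ^ (-(α - 1)) ≤
        N + (α - 1) * (N + 2 * α * N) + (α - 1) * α * N := by
      intro z hz
      obtain ⟨h1, h2, h3, h4⟩ := memBloch_diskKernel hα (hφm hz)
      have h := test _ h1 h2 z hz
      have hν := one_sub_sq_pos hz
      have hd := one_sub_sq_pos (hφm hz)
      have hb₂ := bound₂ z hz
      have hb₁ := bound₁ z hz
      have hφ1 := mem_unitDisk.1 (hφm hz)
      have hα1 : 0 < α - 1 := by linarith
      have hα1' : ‖(α - 1 : ℂ)‖ = α - 1 := by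
        rw [← ofReal_one, ← ofReal_sub, Complex.norm_real, Real.norm_of_nonneg (by linarith)]
      rw [h3, h4] at h
      set Y := 2 * deriv u z * deriv φ z + u z * deriv (deriv φ) z
      set P := deriv (deriv u) z * diskKernel (φ z) (α - 1) (φ z)
      set Q := Y * ((α - 1) * (starRingEnd ℂ) (φ z) * diskKernel (φ z) α (φ z))
      set S := u z * deriv φ z ^ 2 *
        ((α - 1) * α * (starRingEnd ℂ) (φ z) ^ 2 * diskKernel (φ z) (α + 1) (φ z))
      have hP : ‖P‖ = ‖deriv (deriv u) z‖ * (1 - ‖φ z‖ ^ 2) ^ (-(α - 1)) := by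
        rw [norm_mul, norm_diskKernel_self _ (hφm hz)]
      have hQ : ‖Q‖ = (α - 1) * ‖φ z‖ * (‖Y‖ * (1 - ‖φ z‖ ^ 2) ^ (-α)) := by
        simp only [Q, norm_mul, hα1', RCLike.norm_conj, norm_diskKernel_self _ (hφm hz)]
        ring
      have hS : ‖S‖ = (α - 1) * α * ‖φ z‖ ^ 2 *
          (‖u z‖ * ‖deriv φ z‖ ^ 2 * (1 - ‖φ z‖ ^ 2) ^ (-(α + 1))) := by
        simp only [S, norm_mul, norm_pow, hα1', RCLike.norm_conj, Complex.norm_real,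
          Real.norm_of_nonneg (by linarith : (0:ℝ) ≤ α), norm_diskKernel_self _ (hφm hz)]
        ring
      have ht : ‖P‖ ≤ ‖P + Q + S‖ + ‖Q‖ + ‖S‖ := by
        linarith [norm_le_add_norm_add P Q, norm_le_add_norm_add (P + Q) S]
      rw [hP, hQ, hS] at ht
      have hY : 0 ≤ (1 - ‖z‖ ^ 2) ^ β := by positivity
      have hmul := mul_le_mul_of_nonneg_left ht hY
      calc _ = (1 - ‖z‖ ^ 2) ^ β *
            (‖deriv (deriv u) z‖ * (1 - ‖φ z‖ ^ 2) ^ (-(α - 1))) := by ring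
        _ ≤ _ := hmul
        _ = (1 - ‖z‖ ^ 2) ^ β * ‖P + Q + S‖
            + (α - 1) * ‖φ z‖ * ((1 - ‖z‖ ^ 2) ^ β * ‖Y‖ * (1 - ‖φ z‖ ^ 2) ^ (-α))
            + (α - 1) * α * ‖φ z‖ ^ 2 * ((1 - ‖z‖ ^ 2) ^ β *
            (‖u z‖ * ‖deriv φ z‖ ^ 2) * (1 - ‖φ z‖ ^ 2) ^ (-(α + 1))) := by ring
        _ ≤ N + (α - 1) * 1 * (N + 2 * α * N) + (α - 1) * α * 1 ^ 2 * N := by gcongr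
        _ = _ := by ring
    refine ⟨⟨_, fun z hz =>
      (div_rpow_eq_mul_rpow_neg (one_sub_sq_pos (hφm hz)).le _ _).trans_le (bound₁ z hz)⟩,
      ⟨_, fun z hz =>
      (div_rpow_eq_mul_rpow_neg (one_sub_sq_pos (hφm hz)).le _ _).trans_le (bound₂ z hz)⟩,
      ⟨_, fun z hz =>
      (div_rpow_eq_mul_rpow_neg (one_sub_sq_pos (hφm hz)).le _ _).trans_le (bound₀ z hz)⟩⟩
  · rintro ⟨⟨C₁, h₁⟩, ⟨C₂, h₂⟩, ⟨C₀, h₀⟩⟩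
    set K := 1 + (2:ℝ) ^ (α - 1) / (α - 1)
    have hK : 0 ≤ K := by
      have : 0 < α - 1 := by linarith
      positivity
    have main : ∀ f, MemBloch α f → ∀ z ∈ unitDisk,
        (1 - ‖z‖ ^ 2) ^ β * ‖deriv (deriv (wcomp u φ f)) z‖ ≤
          (C₀ * K + C₁ + C₂ * 4 ^ (α + 1)) * blochNorm α f := by
      intro f hf z hz
      have hw := hφm hz
      have hν := one_sub_sq_pos hz
      have hd := one_sub_sq_pos hw
      have a₁ := h₁ z hz
      have a₂ := h₂ z hz
      have a₀ := h₀ z hz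
      rw [div_rpow_eq_mul_rpow_neg hd.le] at a₁ a₂ a₀
      have hL : wnorm α (deriv f) ≤ blochNorm α f := le_add_of_nonneg_left (norm_nonneg _)
      have hL0 : 0 ≤ blochNorm α f := (wnorm_nonneg _ _).trans hL
      rw [deriv_deriv_wcomp hu hφd hφm hf.1 hz]
      set Y := 2 * deriv u z * deriv φ z + u z * deriv (deriv φ) z
      calc _ ≤ (1 - ‖z‖ ^ 2) ^ β * (‖deriv (deriv u) z‖ * ‖f (φ z)‖ + ‖Y‖ * ‖deriv f (φ z)‖
            + ‖u z‖ * ‖deriv φ z‖ ^ 2 * ‖deriv (deriv f) (φ z)‖) := by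
            gcongr
            refine norm_add₃_le.trans (le_of_eq ?_)
            simp only [norm_mul, norm_pow]
        _ ≤ (1 - ‖z‖ ^ 2) ^ β * (
            ‖deriv (deriv u) z‖ * (K * blochNorm α f * (1 - ‖φ z‖ ^ 2) ^ (-(α - 1)))
            + ‖Y‖ * (blochNorm α f * (1 - ‖φ z‖ ^ 2) ^ (-α))
            + ‖u z‖ * ‖deriv φ z‖ ^ 2 *
              (4 ^ (α + 1) * blochNorm α f * (1 - ‖φ z‖ ^ 2) ^ (-(α + 1)))) := by
            gcongr
            · exact norm_le_of_memBloch hα hf hw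
            · exact (norm_deriv_le_of_memBloch hf hw).trans (by gcongr)
            · exact (norm_deriv_deriv_le_of_memBloch (by linarith) hf hw).trans (by gcongr)
        _ = ((1 - ‖z‖ ^ 2) ^ β * ‖deriv (deriv u) z‖ * (1 - ‖φ z‖ ^ 2) ^ (-(α - 1)) * K
            + (1 - ‖z‖ ^ 2) ^ β * ‖Y‖ * (1 - ‖φ z‖ ^ 2) ^ (-α)
            + (1 - ‖z‖ ^ 2) ^ β * (‖u z‖ * ‖deriv φ z‖ ^ 2) * (1 - ‖φ z‖ ^ 2) ^ (-(α + 1))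
              * 4 ^ (α + 1)) * blochNorm α f := by ring
        _ ≤ _ := by gcongr
    have h0 := zero_mem_unitDisk
    have hd := one_sub_sq_pos (hφm h0)
    set d := 1 - ‖φ 0‖ ^ 2
    set A := C₀ * K + C₁ + C₂ * 4 ^ (α + 1)
    set A₀ := K * d ^ (-(α - 1))
    have hA₀ : 0 ≤ A₀ := by positivity
    refine ⟨fun f hf => ⟨fun z hz =>
      (hasDerivAt_wcomp hu hφd hφm hf.1 hz).differentiableAt.differentiableWithinAt,
      bddAbove_weighted (main f hf)⟩, ‖u 0‖ * A₀ + (‖deriv u 0‖ * A₀ +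
        ‖u 0‖ * d ^ (-α) * ‖deriv φ 0‖) + |A| + 1, by positivity, fun f hf => ?_⟩
    have hL : wnorm α (deriv f) ≤ blochNorm α f := le_add_of_nonneg_left (norm_nonneg _)
    have hL0 : 0 ≤ blochNorm α f := (wnorm_nonneg _ _).trans hL
    have hf0 : ‖f (φ 0)‖ ≤ A₀ * blochNorm α f :=
      (norm_le_of_memBloch hα hf (hφm h0)).trans_eq (by ring)
    have hf1 : ‖deriv f (φ 0)‖ ≤ d ^ (-α) * blochNorm α f :=
      (norm_deriv_le_of_memBloch hf (hφm h0)).trans (by rw [mul_comm]; gcongr)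
    have e₀ : ‖wcomp u φ f 0‖ ≤ ‖u 0‖ * (A₀ * blochNorm α f) := by
      rw [wcomp, norm_mul]
      gcongr
    have e₁ : ‖deriv (wcomp u φ f) 0‖ ≤ ‖deriv u 0‖ * (A₀ * blochNorm α f) +
        ‖u 0‖ * (d ^ (-α) * blochNorm α f) * ‖deriv φ 0‖ := by
      rw [(hasDerivAt_wcomp hu hφd hφm hf.1 h0).deriv]
      refine (norm_add_le _ _).trans ?_
      simp only [wcomp, norm_mul]
      gcongr
    have e₂ : wnorm β (deriv (deriv (wcomp u φ f))) ≤ |A| * blochNorm α f :=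
      wnorm_le fun z hz => (main f hf z hz).trans (by gcongr; exact le_abs_self A)
    calc zygNorm β (wcomp u φ f) ≤ _ := add_le_add (add_le_add e₀ e₁) e₂
      _ = (‖u 0‖ * A₀ + (‖deriv u 0‖ * A₀ + ‖u 0‖ * d ^ (-α) * ‖deriv φ 0‖) + |A|) *
          blochNorm α f := by ring
      _ ≤ _ := mul_le_mul_of_nonneg_right (by linarith) hL0

end
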